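/- arXiv:math/0509096 — 3 statements merged into one kernel-verified Lean document; each statement's English description precedes it below -/
import Mathlib

section
/- Let φ : ℝ → ℂ be measurable with both φ and x ↦ |x| φ(x) integrable, and for j ∈ ℕ define, for functions h = h(x,t) on ℝ², Δ_j h(x,t) = ∫ 2^j φ(2^j(x−y)) h(y,t) dy. Let p1, p∞, q∞, q2 ∈ [2,∞] with 1/p1 + 1/p∞ = 1/2 and 1/q∞ + 1/q2 = 1/2. There exists C > 0, depending only on φ, such that for all measurable f, g : ℝ × ℝ → ℂ with g(·,t) absolutely continuous in x for a.e. t, ‖ Δ_j(g f) − g Δ_j f ‖_{L²(ℝ²)} ≤ C 2^{−j} ‖∂_x g‖_{L^{p1}_x(L^{q∞}_t)} ‖f‖_{L^{p∞}_x(L^{q2}_t)}. -/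
open MeasureTheory
open scoped ENNReal NNReal

noncomputable section

/-- `L^p` norm (in `ℝ≥0∞`) of an `ℝ≥0∞`-valued function on `ℝ`. -/
def lpNormE (p : ℝ≥0∞) (F : ℝ → ℝ≥0∞) : ℝ≥0∞ :=
  if p = ∞ then essSup F (volume : Measure ℝ)
  else (∫⁻ x : ℝ, F x ^ p.toReal) ^ (1 / p.toReal)

/-- Mixed norm `‖h‖_{L^p_x(L^q_t)}` for `h = h(x,t)`. -/
def mixedNormXT (p q : ℝ≥0∞) (h : ℝ → ℝ → ℂ) : ℝ≥0∞ :=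
  lpNormE p fun x => lpNormE q fun t => (‖h x t‖₊ : ℝ≥0∞)

/-- Littlewood–Paley piece in the `x` variable:
`Δ_j h(x,t) = ∫ 2^j φ(2^j (x-y)) h(y,t) dy`. -/
def LPblockX (φ : ℝ → ℂ) (j : ℕ) (h : ℝ → ℝ → ℂ) : ℝ → ℝ → ℂ :=
  fun x t => ∫ y : ℝ, ((2 : ℝ) ^ j : ℝ) * φ ((2 : ℝ) ^ j * (x - y)) * h y t

/-! ### One-variable norms -/

theorem ae_le_lpNormE_top (F : ℝ → ℝ≥0∞) : ∀ᵐ x : ℝ, F x ≤ lpNormE ∞ F := by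
  simpa [lpNormE] using ENNReal.ae_le_essSup (μ := (volume : Measure ℝ)) F

theorem lpNormE_comp_sub_right (p : ℝ≥0∞) {F : ℝ → ℝ≥0∞} (hF : Measurable F) (a : ℝ) :
    lpNormE p (fun x => F (x - a)) = lpNormE p F := by
  unfold lpNormE
  split_ifs
  · have h := measurePreserving_sub_right (volume : Measure ℝ) a
    have h' := essSup_map_measure (μ := (volume : Measure ℝ)) (f := fun x : ℝ => x - a) (g := F)
      hF.aemeasurable h.measurable.aemeasurable
    rw [h.map_eq] at h'
    exact h'.symm
  · rw [lintegral_sub_right_eq_self (fun x => F x ^ p.toReal) a]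

theorem lpNormE_zero {p : ℝ≥0∞} (hp : p ≠ 0) : lpNormE p (fun _ => 0) = 0 := by
  unfold lpNormE
  split_ifs with h
  · simp
  · have := ENNReal.toReal_pos hp h
    simp [this]

theorem lpNormE_indicator_const_ne_top {p : ℝ≥0∞} (hp : p ≠ 0) {s : Set ℝ}
    (hs : MeasurableSet s) (hs' : volume s ≠ ∞) {c : ℝ≥0∞} (hc : c ≠ ∞) :
    lpNormE p (s.indicator fun _ => c) ≠ ∞ := by
  unfold lpNormE
  split_ifs with h
  · refine ne_top_of_le_ne_top hc (essSup_le_of_ae_le _ (Filter.Eventually.of_forall fun x => ?_))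
    exact Set.indicator_le_self' (fun _ _ => zero_le) x
  · have hp' := ENNReal.toReal_pos hp h
    have : ∀ x, (s.indicator (fun _ => c) x) ^ p.toReal
        = s.indicator (fun _ => c ^ p.toReal) x := by
      intro x
      by_cases hx : x ∈ s <;> simp [hx, hp']
    simp_rw [this]
    rw [lintegral_indicator_const hs]
    exact ENNReal.rpow_ne_top_of_nonneg (by positivity)
      (ENNReal.mul_ne_top (ENNReal.rpow_ne_top_of_nonneg hp'.le hc) hs')

theorem ae_eq_zero_of_lpNormE_eq_zero {p : ℝ≥0∞} (hp : p ≠ 0) {F : ℝ → ℝ≥0∞}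
    (hF : Measurable F) (h : lpNormE p F = 0) : ∀ᵐ x : ℝ, F x = 0 := by
  unfold lpNormE at h
  split_ifs at h with hp'
  · exact ENNReal.essSup_eq_zero_iff.1 h
  · have hp0 := ENNReal.toReal_pos hp hp'
    have h0 : ∫⁻ x : ℝ, F x ^ p.toReal = 0 := by
      rcases ENNReal.rpow_eq_zero_iff.1 h with h | h
      · exact h.1
      · exact absurd h.2 (not_lt.2 (by positivity))
    rw [lintegral_eq_zero_iff (hF.pow_const _)] at h0
    filter_upwards [h0] with x hx
    rcases ENNReal.rpow_eq_zero_iff.1 hx with h | h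
    · exact h.1
    · exact absurd h.2 (not_lt.2 hp0.le)

theorem measurable_lpNormE (p : ℝ≥0∞) {F : ℝ → ℝ → ℝ≥0∞}
    (hF : Measurable (Function.uncurry F)) : Measurable fun x => lpNormE p (F x) := by
  unfold lpNormE
  split_ifs with h
  · refine measurable_of_Iic fun c => ?_
    have hset : (fun x => essSup (F x) (volume : Measure ℝ)) ⁻¹' Set.Iic c
        = {x | volume (Prod.mk x ⁻¹' {z : ℝ × ℝ | c < Function.uncurry F z}) = 0} := by
      ext x
      have : volume (Prod.mk x ⁻¹' {z : ℝ × ℝ | c < Function.uncurry F z}) = 0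
          ↔ ∀ᵐ t : ℝ, F x t ≤ c := by
        rw [ae_iff]
        simp [Function.uncurry]
      simp only [Set.mem_preimage, Set.mem_Iic, Set.mem_ofPred_eq] at this ⊢
      rw [this]
      refine ⟨fun hx => ?_, fun hx => essSup_le_of_ae_le _ hx⟩
      filter_upwards [ENNReal.ae_le_essSup (μ := (volume : Measure ℝ)) (F x)] with t ht
      exact ht.trans hx
    rw [hset]
    exact measurable_measure_prodMk_left (measurableSet_lt measurable_const hF)
      (measurableSet_singleton 0)
  · exact ((hF.pow_const _).lintegral_prod_right').pow_const _

/-! ### Hölder's inequality into `L²` -/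

theorem lintegral_mul_sq_le_of_left_top {q : ℝ≥0∞} (h : 1 / (∞ : ℝ≥0∞) + 1 / q = 1 / 2)
    (F : ℝ → ℝ≥0∞) {G : ℝ → ℝ≥0∞} (hG : Measurable G) :
    ∫⁻ x, (F x * G x) ^ 2 ≤ (lpNormE ∞ F * lpNormE q G) ^ 2 := by
  have hq : q = 2 := by simpa using h
  subst hq
  have hG2 : lpNormE 2 G ^ 2 = ∫⁻ x, G x ^ 2 := by
    simp only [lpNormE, ENNReal.ofNat_ne_top, if_false, ENNReal.toReal_ofNat, ENNReal.rpow_ofNat]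
    rw [← ENNReal.rpow_natCast, ← ENNReal.rpow_mul]
    norm_num
  rw [mul_pow, hG2, ← lintegral_const_mul _ (hG.pow_const 2)]
  refine lintegral_mono_ae ?_
  filter_upwards [ae_le_lpNormE_top F] with x hx
  rw [mul_pow]
  gcongr

theorem ne_zero_of_one_div_add_eq_half {p q : ℝ≥0∞} (h : 1 / p + 1 / q = 1 / 2) : p ≠ 0 := by
  rintro rfl
  have := congrArg (· = ∞) h
  simp at this

theorem lintegral_mul_sq_le {p q : ℝ≥0∞} (h : 1 / p + 1 / q = 1 / 2)
    {F G : ℝ → ℝ≥0∞} (hF : Measurable F) (hG : Measurable G) :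
    ∫⁻ x, (F x * G x) ^ 2 ≤ (lpNormE p F * lpNormE q G) ^ 2 := by
  by_cases hp : p = ∞
  · subst hp
    exact lintegral_mul_sq_le_of_left_top h F hG
  by_cases hq : q = ∞
  · subst hq
    rw [add_comm] at h
    simpa only [mul_comm] using lintegral_mul_sq_le_of_left_top h G hF
  have hp0 : p ≠ 0 := ne_zero_of_one_div_add_eq_half h
  have hq0 : q ≠ 0 := ne_zero_of_one_div_add_eq_half ((add_comm _ _).trans h)
  have hp' := ENNReal.toReal_pos hp0 hp
  have hq' := ENNReal.toReal_pos hq0 hq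
  have hr : 1 / p.toReal + 1 / q.toReal = 1 / 2 := by
    have := congrArg ENNReal.toReal h
    rw [ENNReal.toReal_add (by simp [hp0]) (by simp [hq0])] at this
    simpa using this
  have h2p : 2 < p.toReal := by
    have : 0 < 1 / q.toReal := by positivity
    exact lt_of_one_div_lt_one_div hp' (by linarith)
  have key := ENNReal.lintegral_Lp_mul_le_Lq_mul_Lr two_pos h2p hr.symm volume
    hF.aemeasurable hG.aemeasurable
  simp only [Pi.mul_apply, ENNReal.rpow_ofNat] at key
  simp only [lpNormE, hp, hq, if_false]
  calc ∫⁻ x, (F x * G x) ^ 2 = ((∫⁻ x, (F x * G x) ^ 2) ^ (1 / (2 : ℝ))) ^ 2 := by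
        rw [← ENNReal.rpow_natCast, ← ENNReal.rpow_mul]
        norm_num
    _ ≤ _ := by gcongr

theorem lintegral_mixed_mul_sq_le {p₁ pinf qinf q₂ : ℝ≥0∞} (hp : 1 / p₁ + 1 / pinf = 1 / 2)
    (hq : 1 / qinf + 1 / q₂ = 1 / 2) {F G : ℝ → ℝ → ℝ≥0∞}
    (hF : Measurable (Function.uncurry F)) (hG : Measurable (Function.uncurry G)) :
    ∫⁻ z : ℝ × ℝ, (F z.1 z.2 * G z.1 z.2) ^ 2 ≤
      (lpNormE p₁ (fun x => lpNormE qinf (F x)) * lpNormE pinf (fun x => lpNormE q₂ (G x))) ^ 2 := by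
  have hm : Measurable fun z : ℝ × ℝ => (F z.1 z.2 * G z.1 z.2) ^ 2 := (hF.mul hG).pow_const 2
  rw [Measure.volume_eq_prod, lintegral_prod _ hm.aemeasurable]
  refine le_trans (lintegral_mono fun x => ?_)
    (lintegral_mul_sq_le hp (measurable_lpNormE qinf hF) (measurable_lpNormE q₂ hG))
  exact lintegral_mul_sq_le hq (hF.comp measurable_prodMk_left) (hG.comp measurable_prodMk_left)

/-- Minkowski's inequality in `L²` when all slices have the same bound. -/
theorem lintegral_sq_lintegral_le {X Z : Type*} [MeasurableSpace X] [MeasurableSpace Z]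
    {μ : Measure X} {ν : Measure Z} [SFinite μ] [SFinite ν] {H : Z → X → ℝ≥0∞}
    (hH : Measurable (Function.uncurry H)) {B : ℝ≥0∞} (hB : ∀ z, ∫⁻ x, H z x ^ 2 ∂μ ≤ B) :
    ∫⁻ x, (∫⁻ z, H z x ∂ν) ^ 2 ∂μ ≤ ν Set.univ ^ 2 * B := by
  have cs : ∀ x, (∫⁻ z, H z x ∂ν) ^ 2 ≤ ν Set.univ * ∫⁻ z, H z x ^ 2 ∂ν := by
    intro x
    have hx : Measurable fun z => H z x := hH.comp measurable_prodMk_right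
    have := ENNReal.lintegral_mul_le_Lp_mul_Lq ν Real.HolderConjugate.two_two
      hx.aemeasurable (aemeasurable_const (b := (1 : ℝ≥0∞)))
    simp only [Pi.mul_apply, mul_one, ENNReal.rpow_ofNat, one_pow, lintegral_const, one_mul] at this
    calc (∫⁻ z, H z x ∂ν) ^ 2
        ≤ ((∫⁻ z, H z x ^ 2 ∂ν) ^ (1 / (2 : ℝ)) * ν Set.univ ^ (1 / (2 : ℝ))) ^ 2 := by gcongr
      _ = ν Set.univ * ∫⁻ z, H z x ^ 2 ∂ν := by
        rw [mul_pow, ← ENNReal.rpow_natCast, ← ENNReal.rpow_natCast, ← ENNReal.rpow_mul,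
          ← ENNReal.rpow_mul, mul_comm]
        norm_num
  have hH2 : Measurable (Function.uncurry fun x z => H z x ^ 2) :=
    (hH.comp measurable_swap).pow_const 2
  calc ∫⁻ x, (∫⁻ z, H z x ∂ν) ^ 2 ∂μ ≤ ∫⁻ x, ν Set.univ * ∫⁻ z, H z x ^ 2 ∂ν ∂μ :=
        lintegral_mono cs
    _ = ν Set.univ * ∫⁻ z, ∫⁻ x, H z x ^ 2 ∂μ ∂ν := by
        have hm : Measurable fun x => ∫⁻ z, H z x ^ 2 ∂ν := hH2.lintegral_prod_right'
        rw [lintegral_const_mul _ hm, lintegral_lintegral_swap hH2.aemeasurable]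
    _ ≤ ν Set.univ * ∫⁻ _, B ∂ν := by
        gcongr with z
        exact hB z
    _ = ν Set.univ ^ 2 * B := by
        rw [lintegral_const]
        ring

/-- An average over translates of two factors obeys the same mixed Hölder bound. -/
theorem lintegral_translates_sq_le {p₁ pinf qinf q₂ : ℝ≥0∞} (hp : 1 / p₁ + 1 / pinf = 1 / 2)
    (hq : 1 / qinf + 1 / q₂ = 1 / 2) {F G : ℝ → ℝ → ℝ≥0∞}
    (hF : Measurable (Function.uncurry F)) (hG : Measurable (Function.uncurry G))
    {Z : Type*} [MeasurableSpace Z] (ν : Measure Z) [SFinite ν] {α β : Z → ℝ}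
    (hα : Measurable α) (hβ : Measurable β) :
    ∫⁻ w : ℝ × ℝ, (∫⁻ z, F (w.1 - α z) w.2 * G (w.1 - β z) w.2 ∂ν) ^ 2 ≤
      (ν Set.univ * (lpNormE p₁ (fun x => lpNormE qinf (F x)) *
        lpNormE pinf (fun x => lpNormE q₂ (G x)))) ^ 2 := by
  rw [mul_pow]
  refine lintegral_sq_lintegral_le
    (H := fun z (w : ℝ × ℝ) => F (w.1 - α z) w.2 * G (w.1 - β z) w.2) ?_ fun z => ?_
  · have h1 : Measurable fun u : Z × (ℝ × ℝ) => (u.2.1 - α u.1, u.2.2) := by fun_prop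
    have h2 : Measurable fun u : Z × (ℝ × ℝ) => (u.2.1 - β u.1, u.2.2) := by fun_prop
    exact (hF.comp h1).mul (hG.comp h2)
  · have hs : ∀ a : ℝ, Measurable fun u : ℝ × ℝ => (u.1 - a, u.2) := fun a => by fun_prop
    have := lintegral_mixed_mul_sq_le hp hq (F := fun x => F (x - α z)) (G := fun x => G (x - β z))
      (hF.comp (hs _)) (hG.comp (hs _))
    rwa [lpNormE_comp_sub_right p₁ (measurable_lpNormE qinf hF),
      lpNormE_comp_sub_right pinf (measurable_lpNormE q₂ hG)] at this

/-! ### Convolution integrability -/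

theorem ae_lintegral_conv_ne_top {p₁ pinf qinf q₂ : ℝ≥0∞} (hp : 1 / p₁ + 1 / pinf = 1 / 2)
    (hq : 1 / qinf + 1 / q₂ = 1 / 2) {k : ℝ → ℝ≥0∞} (hk : Measurable k)
    (hk' : ∫⁻ z, k z ≠ ∞) {F : ℝ → ℝ → ℝ≥0∞} (hF : Measurable (Function.uncurry F))
    (hF' : lpNormE pinf (fun x => lpNormE q₂ (F x)) ≠ ∞) :
    ∀ᵐ w : ℝ × ℝ, ∫⁻ y, k (w.1 - y) * F y w.2 ≠ ∞ := by
  have hp0 : p₁ ≠ 0 := ne_zero_of_one_div_add_eq_half hp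
  have hq0 : qinf ≠ 0 := ne_zero_of_one_div_add_eq_half hq
  have hbox : ∀ n : ℕ, ∀ᵐ w : ℝ × ℝ, w.1 ∈ Set.Icc (-n : ℝ) n → w.2 ∈ Set.Icc (-n : ℝ) n →
      ∫⁻ y, k (w.1 - y) * F y w.2 ≠ ∞ := by
    intro n
    set s := Set.Icc (-n : ℝ) n with hs
    have hsm : MeasurableSet s := measurableSet_Icc
    have hsv : volume s ≠ ∞ := by simp [hs]
    have hone : Measurable (s.indicator fun _ => (1 : ℝ≥0∞)) := measurable_const.indicator hsm
    set G : ℝ → ℝ → ℝ≥0∞ := fun x t => s.indicator (fun _ => 1) x * s.indicator (fun _ => 1) t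
      with hG
    have hGm : Measurable (Function.uncurry G) :=
      (hone.comp measurable_fst).mul (hone.comp measurable_snd)
    have hGn : lpNormE p₁ (fun x => lpNormE qinf (G x)) ≠ ∞ := by
      have : (fun x => lpNormE qinf (G x))
          = s.indicator fun _ => lpNormE qinf (s.indicator fun _ => 1) := by
        funext x
        by_cases hx : x ∈ s
        · simp [hG, hx]
        · simp [hG, hx, lpNormE_zero hq0]
      rw [this]
      exact lpNormE_indicator_const_ne_top hp0 hsm hsv
        (lpNormE_indicator_const_ne_top hq0 hsm hsv ENNReal.one_ne_top)
    have hb := lintegral_translates_sq_le hp hq hGm hF (volume.withDensity k)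
      (α := fun _ => 0) (β := id) measurable_const measurable_id
    have hfin := ne_top_of_le_ne_top (ENNReal.pow_ne_top (ENNReal.mul_ne_top
      (by rwa [withDensity_apply _ MeasurableSet.univ, Measure.restrict_univ])
      (ENNReal.mul_ne_top hGn hF'))) hb
    have hm : Measurable fun w : ℝ × ℝ =>
        (∫⁻ z, G (w.1 - 0) w.2 * F (w.1 - id z) w.2 ∂(volume.withDensity k)) ^ 2 := by
      refine Measurable.pow_const ?_ 2
      have h1 : Measurable fun u : (ℝ × ℝ) × ℝ => (u.1.1 - (0 : ℝ), u.1.2) := by fun_prop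
      have h2 : Measurable fun u : (ℝ × ℝ) × ℝ => (u.1.1 - id u.2, u.1.2) := by fun_prop
      exact ((hGm.comp h1).mul (hF.comp h2)).lintegral_prod_right'
    filter_upwards [ae_lt_top hm hfin] with w hw h1 h2
    have hFw : Measurable fun z => F (w.1 - z) w.2 :=
      hF.comp ((measurable_const.sub measurable_id).prodMk measurable_const)
    simp only [hG, sub_zero, h1, h2, Set.indicator_of_mem, one_mul, id] at hw
    rw [lintegral_withDensity_eq_lintegral_mul _ hk hFw,
      ← lintegral_sub_left_eq_self _ w.1] at hw
    simp only [Pi.mul_apply, sub_sub_cancel] at hw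
    intro htop
    simp [htop] at hw
  filter_upwards [ae_all_iff.2 hbox] with w hw
  obtain ⟨n, hn⟩ := exists_nat_ge (max |w.1| |w.2|)
  exact hw n (abs_le.1 ((le_max_left _ _).trans hn)) (abs_le.1 ((le_max_right _ _).trans hn))

/-! ### Pointwise bounds -/

theorem enorm_commutator_le {k F G : ℝ → ℂ} (hk : Measurable k) (hF : Measurable F)
    (hG : Measurable G) (c : ℂ) (hint : Integrable fun y => k y * F y) :
    ‖(∫ y, k y * (G y * F y)) - c * ∫ y, k y * F y‖ₑ ≤
      ∫⁻ y, ‖k y‖ₑ * ‖G y - c‖ₑ * ‖F y‖ₑ := by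
  have hdiff : ∀ y, k y * (G y * F y) - c * (k y * F y) = k y * (G y - c) * F y := fun y => by ring
  by_cases h : Integrable fun y => k y * (G y * F y)
  · rw [← integral_const_mul, ← integral_sub h (hint.const_mul c)]
    refine (enorm_integral_le_lintegral_enorm _).trans_eq (lintegral_congr fun y => ?_)
    rw [hdiff, enorm_mul, enorm_mul]
  · have htop : ∫⁻ y, ‖k y‖ₑ * ‖G y - c‖ₑ * ‖F y‖ₑ = ∞ := by
      by_contra hne
      refine h ?_
      have hi : Integrable fun y => k y * (G y - c) * F y := by
        refine ⟨((hk.mul (hG.sub_const c)).mul hF).aestronglyMeasurable, ?_⟩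
        simpa only [HasFiniteIntegral, enorm_mul] using lt_top_iff_ne_top.2 hne
      refine (hi.add (hint.const_mul c)).congr (Filter.Eventually.of_forall fun y => ?_)
      simp only [Pi.add_apply]
      ring
    rw [htop]
    exact le_top

theorem enorm_sub_le_of_eq_intervalIntegral {G G' : ℝ → ℂ}
    (h : ∀ a b : ℝ, G b - G a = ∫ x in a..b, G' x) (x z : ℝ) :
    ‖G (x - z) - G x‖ₑ ≤ ‖z‖ₑ * ∫⁻ s in Set.Ioc (0 : ℝ) 1, ‖G' (x - z * s)‖ₑ := by
  have hsub := intervalIntegral.smul_integral_comp_add_mul (a := 0) (b := 1) G' (-z) x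
  have : G (x - z) - G x = (-z) • ∫ s in (0 : ℝ)..1, G' (x - z * s) := by
    rw [h]
    simpa [sub_eq_add_neg] using hsub.symm
  rw [this, enorm_smul, enorm_neg, intervalIntegral.integral_of_le zero_le_one]
  gcongr
  exact enorm_integral_le_lintegral_enorm _

/-- **Mixed-norm commutator estimate**
`‖[Δ_j, g] f‖_{L²(ℝ²)} ≤ C 2^{-j} ‖∂_x g‖_{L^{p₁}_x(L^{q_∞}_t)} ‖f‖_{L^{p_∞}_x(L^{q₂}_t)}`,
for exponents in `[2,∞]` with `1/p₁ + 1/p_∞ = 1/2` and `1/q_∞ + 1/q₂ = 1/2`, where `g`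
is absolutely continuous in `x` with derivative `g'` for a.e. `t`. -/
theorem commutator_mixed_norm
    (φ : ℝ → ℂ) (hφmeas : Measurable φ)
    (hφint : Integrable φ (volume : Measure ℝ))
    (hθint : Integrable (fun x : ℝ => |x| * ‖φ x‖) (volume : Measure ℝ)) :
    ∃ C : ℝ, 0 < C ∧
      ∀ (p₁ pinf qinf q₂ : ℝ≥0∞),
        2 ≤ p₁ → 2 ≤ pinf → 2 ≤ qinf → 2 ≤ q₂ →
        1 / p₁ + 1 / pinf = 1 / 2 → 1 / qinf + 1 / q₂ = 1 / 2 →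
        ∀ (j : ℕ) (f g g' : ℝ → ℝ → ℂ),
          Measurable (fun p : ℝ × ℝ => f p.1 p.2) →
          Measurable (fun p : ℝ × ℝ => g p.1 p.2) →
          Measurable (fun p : ℝ × ℝ => g' p.1 p.2) →
          (∀ᵐ t : ℝ, ∀ a b : ℝ, g b t - g a t = ∫ x in a..b, g' x t) →
          eLpNorm
              (fun p : ℝ × ℝ =>
                LPblockX φ j (fun y t => g y t * f y t) p.1 p.2 -
                  g p.1 p.2 * LPblockX φ j f p.1 p.2)
              2 (volume : Measure (ℝ × ℝ))
            ≤ ENNReal.ofReal (C * (2 : ℝ) ^ (-(j : ℝ))) *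
              mixedNormXT p₁ qinf g' * mixedNormXT pinf q₂ f := by
  set θ : ℝ := ∫ x : ℝ, |x| * ‖φ x‖ with hθ
  have hθ0 : 0 ≤ θ := integral_nonneg fun x => by positivity
  refine ⟨θ + 1, by positivity, ?_⟩
  intro p₁ pinf qinf q₂ _ _ _ _ hp hq j f g g' hf hg hg' hac
  have hp0 : p₁ ≠ 0 := ne_zero_of_one_div_add_eq_half hp
  have hq0 : qinf ≠ 0 := ne_zero_of_one_div_add_eq_half hq
  have hj : (0 : ℝ) < 2 ^ j := by positivity
  set k : ℝ → ℂ := fun z => ((2 : ℝ) ^ j : ℝ) * φ ((2 : ℝ) ^ j * z) with hk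
  have hkm : Measurable k := by fun_prop
  have hkint : Integrable k := (hφint.comp_mul_left' hj.ne').const_mul _
  have hkf : ∀ z, ‖k z‖ * |z| = |2 ^ j * z| * ‖φ (2 ^ j * z)‖ := by
    intro z
    rw [hk]
    simp only [norm_mul, Complex.norm_real, Real.norm_eq_abs, abs_mul, abs_of_pos hj]
    ring
  have hmass : ∫⁻ z, ‖k z‖ₑ * ‖z‖ₑ = ENNReal.ofReal (θ * (2 : ℝ) ^ (-(j : ℝ))) := by
    have hi := hθint.comp_mul_left' hj.ne'
    have h1 := Measure.integral_comp_mul_left (fun x : ℝ => |x| * ‖φ x‖) (2 ^ j)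
    have h2 := ofReal_integral_eq_lintegral_ofReal hi
      (Filter.Eventually.of_forall fun x => by positivity)
    rw [h1, abs_of_pos (inv_pos.2 hj), smul_eq_mul] at h2
    rw [Real.rpow_neg two_pos.le, Real.rpow_natCast, mul_comm, h2]
    refine lintegral_congr fun z => ?_
    rw [← hkf, ENNReal.ofReal_mul (norm_nonneg _), ofReal_norm, ← Real.norm_eq_abs, ofReal_norm]
  have hFm : Measurable (Function.uncurry fun x t => ‖f x t‖ₑ) := hf.enorm
  have hGm : Measurable (Function.uncurry fun x t => ‖g' x t‖ₑ) := hg'.enorm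
  have hac' : ∀ᵐ w : ℝ × ℝ, ∀ a b : ℝ, g b w.2 - g a w.2 = ∫ x in a..b, g' x w.2 :=
    Measure.quasiMeasurePreserving_snd.ae hac
  have hconst : 0 < ENNReal.ofReal ((θ + 1) * (2 : ℝ) ^ (-(j : ℝ))) :=
    ENNReal.ofReal_pos.2 (by positivity)
  have hsec : ∀ {h : ℝ → ℝ → ℂ}, Measurable (fun p : ℝ × ℝ => h p.1 p.2) →
      ∀ t, Measurable fun y => h y t :=
    fun h t => h.comp measurable_prodMk_right
  by_cases hN : mixedNormXT pinf q₂ f = ∞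
  · by_cases hM : mixedNormXT p₁ qinf g' = 0
    · have h0 : ∀ᵐ x : ℝ, ∀ᵐ t : ℝ, g' x t = 0 := by
        filter_upwards [ae_eq_zero_of_lpNormE_eq_zero hp0 (measurable_lpNormE qinf hGm) hM]
          with x hx
        filter_upwards [ae_eq_zero_of_lpNormE_eq_zero hq0
          (hGm.comp measurable_prodMk_left) hx] with t ht
        simpa using ht
      rw [Measure.ae_ae_comm (p := fun x t => g' x t = 0)
        (hg' (measurableSet_singleton 0))] at h0
      have hz : (fun p : ℝ × ℝ => LPblockX φ j (fun y t => g y t * f y t) p.1 p.2 -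
          g p.1 p.2 * LPblockX φ j f p.1 p.2) =ᵐ[volume] 0 := by
        filter_upwards [hac', Measure.quasiMeasurePreserving_snd.ae h0] with w hw hw0
        have hc : ∀ y, g y w.2 = g w.1 w.2 := by
          intro y
          have hi : ∫ x in w.1..y, g' x w.2 = ∫ x in w.1..y, (0 : ℂ) :=
            intervalIntegral.integral_congr_ae (by filter_upwards [hw0] with x hx _ using hx)
          rw [← sub_eq_zero, hw, hi, intervalIntegral.integral_zero]
        simp only [LPblockX, hc, Pi.zero_apply, ← integral_const_mul]
        rw [sub_eq_zero]
        exact integral_congr_ae (Filter.Eventually.of_forall fun y => by ring)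
      rw [eLpNorm_congr_ae hz, eLpNorm_zero]
      exact zero_le
    · rw [hN, ENNReal.mul_top (mul_ne_zero hconst.ne' hM)]
      exact le_top
  have hint := ae_lintegral_conv_ne_top hp hq (k := fun z => ‖k z‖ₑ) hkm.enorm hkint.2.ne hFm hN
  set D : ℝ × ℝ → ℝ≥0∞ := fun w => ∫⁻ z : ℝ × ℝ, ‖g' (w.1 - z.1 * z.2) w.2‖ₑ *
    ‖f (w.1 - z.1) w.2‖ₑ ∂((volume.withDensity fun z => ‖k z‖ₑ * ‖z‖ₑ).prod
      (volume.restrict (Set.Ioc 0 1))) with hD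
  have hκ : Measurable fun z : ℝ => ‖k z‖ₑ * ‖z‖ₑ := hkm.enorm.mul measurable_enorm
  have hDle := lintegral_translates_sq_le hp hq hGm hFm
    ((volume.withDensity fun z => ‖k z‖ₑ * ‖z‖ₑ).prod (volume.restrict (Set.Ioc (0 : ℝ) 1)))
    (α := fun z => z.1 * z.2) (β := Prod.fst) (by fun_prop) (by fun_prop)
  rw [← Set.univ_prod_univ, Measure.prod_prod, withDensity_apply _ MeasurableSet.univ,
    Measure.restrict_univ, hmass, Measure.restrict_apply_univ, Real.volume_Ioc, sub_zero,
    ENNReal.ofReal_one, mul_one] at hDle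
  have hpt : ∀ᵐ w : ℝ × ℝ, ‖LPblockX φ j (fun y t => g y t * f y t) w.1 w.2 -
      g w.1 w.2 * LPblockX φ j f w.1 w.2‖ₑ ≤ D w := by
    filter_upwards [hac', hint] with w hw hwi
    have hkw : Measurable fun y => k (w.1 - y) := by fun_prop
    have hfw := hsec hf w.2
    have hgw := hsec hg' w.2
    refine (enorm_commutator_le hkw hfw (hsec hg w.2) (g w.1 w.2)
      ⟨(hkw.mul hfw).aestronglyMeasurable, ?_⟩).trans ?_
    · simpa only [HasFiniteIntegral, enorm_mul] using lt_top_iff_ne_top.2 hwi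
    rw [← lintegral_sub_left_eq_self _ w.1]
    have hm : Measurable fun z : ℝ × ℝ => ‖g' (w.1 - z.1 * z.2) w.2‖ₑ * ‖f (w.1 - z.1) w.2‖ₑ :=
      (hgw.comp (by fun_prop : Measurable fun z : ℝ × ℝ => w.1 - z.1 * z.2)).enorm.mul
        (hfw.comp (by fun_prop : Measurable fun z : ℝ × ℝ => w.1 - z.1)).enorm
    simp only [hD]
    rw [lintegral_prod _ hm.aemeasurable,
      lintegral_withDensity_eq_lintegral_mul _ hκ hm.lintegral_prod_right']
    refine lintegral_mono fun z => ?_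
    simp only [sub_sub_cancel, Pi.mul_apply]
    have hz : Measurable fun s : ℝ => ‖g' (w.1 - z * s) w.2‖ₑ :=
      (hgw.comp (by fun_prop : Measurable fun s : ℝ => w.1 - z * s)).enorm
    rw [lintegral_mul_const _ hz]
    calc ‖k z‖ₑ * ‖g (w.1 - z) w.2 - g w.1 w.2‖ₑ * ‖f (w.1 - z) w.2‖ₑ
        ≤ ‖k z‖ₑ * (‖z‖ₑ * ∫⁻ s in Set.Ioc (0 : ℝ) 1, ‖g' (w.1 - z * s) w.2‖ₑ) *
          ‖f (w.1 - z) w.2‖ₑ := by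
          gcongr
          exact enorm_sub_le_of_eq_intervalIntegral hw w.1 z
      _ = _ := by ring
  rw [eLpNorm_eq_lintegral_rpow_enorm_toReal two_ne_zero ENNReal.ofNat_ne_top]
  simp only [ENNReal.toReal_ofNat, ENNReal.rpow_ofNat]
  calc _ ≤ (∫⁻ w, D w ^ 2) ^ (1 / (2 : ℝ)) := by
        refine ENNReal.rpow_le_rpow (lintegral_mono_ae ?_) (by norm_num)
        filter_upwards [hpt] with w hw
        gcongr
    _ ≤ ((ENNReal.ofReal (θ * (2 : ℝ) ^ (-(j : ℝ))) *
          (mixedNormXT p₁ qinf g' * mixedNormXT pinf q₂ f)) ^ 2) ^ (1 / (2 : ℝ)) :=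
        ENNReal.rpow_le_rpow hDle (by norm_num)
    _ = ENNReal.ofReal (θ * (2 : ℝ) ^ (-(j : ℝ))) *
          (mixedNormXT p₁ qinf g' * mixedNormXT pinf q₂ f) := by
        rw [← ENNReal.rpow_natCast, ← ENNReal.rpow_mul]
        norm_num
    _ ≤ _ := by
        rw [← mul_assoc]
        gcongr
        linarith

end
end

section
/- There exists a universal constant C > 0 with the following property (one-dimensional bilinear smoothing for frequency-separated Schrödinger waves). Let f, g : ℝ → ℂ be continuous and compactly supported, and let μ > 0 be such that |η − λ| ≥ μ for all η ∈ supp f and all λ ∈ supp g. Define u(t,x) = ∫_ℝ e^{i(xη − tη²)} f(η) dη and v(t,x) = ∫_ℝ e^{i(xη − tη²)} g(η) dη. Then ∫∫_{ℝ²} |u(t,x) v(t,x)|² dx dt ≤ (C/μ) ‖f‖²_{L²(ℝ)} ‖g‖²_{L²(ℝ)}. -/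
open MeasureTheory
open scoped ENNReal NNReal

noncomputable section

open FourierTransform SchwartzMap
open scoped Real

/-- On `L¹ ∩ L²` the Fourier integral agrees with the `L²` Fourier transform. -/
theorem fourier_ae_eq_fourier_toLp {h : ℝ → ℂ} (h1 : Integrable h) (h2 : MemLp h 2) :
    𝓕 h =ᵐ[volume] (𝓕 (h2.toLp h) : Lp (α := ℝ) ℂ 2) := by
  have hc : Continuous (𝓕 h) :=
    VectorFourier.fourierIntegral_continuous Real.continuous_fourierChar continuous_inner h1
  refine ae_eq_of_integral_contDiff_smul_eq hc.locallyIntegrable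
    ((Lp.memLp _).locallyIntegrable (by norm_num)) fun φ hφ hφc ↦ ?_
  have hφ' : ContDiff ℝ (⊤ : ℕ∞) (fun x ↦ (φ x : ℂ)) := Complex.ofRealCLM.contDiff.comp hφ
  have hφc' : HasCompactSupport (fun x ↦ (φ x : ℂ)) := hφc.comp_left (g := Complex.ofReal) rfl
  set ψ : 𝓢(ℝ, ℂ) := hφc'.toSchwartzMap hφ'
  have e1 := congrArg (fun T : TemperedDistribution ℝ ℂ ↦ T ψ)
    (Lp.fourier_toTemperedDistribution_eq (h2.toLp h))
  simp only [TemperedDistribution.fourier_apply, Lp.toTemperedDistribution_apply] at e1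
  have e2 : ∫ x, 𝓕 (ψ : ℝ → ℂ) x • h x = ∫ x, ψ x • 𝓕 h x := by
    simpa using! VectorFourier.integral_fourierIntegral_smul_eq_flip (L := innerₗ ℝ)
      Real.continuous_fourierChar continuous_inner ψ.integrable h1
  have e3 : ∫ x, (𝓕 ψ) x • (h2.toLp h) x = ∫ x, 𝓕 (ψ : ℝ → ℂ) x • h x := by
    refine integral_congr_ae ?_
    filter_upwards [h2.coeFn_toLp] with x hx
    rw [hx, SchwartzMap.fourier_coe]
  have hψx : ∀ x, ψ x = (φ x : ℂ) := fun x ↦ rfl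
  rw [e3, e2] at e1
  simpa [hψx] using e1

/-- The Plancherel inequality for integrable functions, with values in `[0, ∞]`. -/
theorem lintegral_enorm_fourier_sq_le {h : ℝ → ℂ} (h1 : Integrable h) :
    ∫⁻ w, ‖𝓕 h w‖ₑ ^ 2 ≤ ∫⁻ x, ‖h x‖ₑ ^ 2 := by
  have key (k : ℝ → ℂ) : ∫⁻ x, ‖k x‖ₑ ^ 2 = eLpNorm k 2 volume ^ 2 := by
    simpa using (eLpNorm_nnreal_pow_eq_lintegral (f := k) (μ := volume) (p := 2) (by norm_num)).symm
  by_cases h2 : MemLp h 2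
  · rw [key, key, eLpNorm_congr_ae (fourier_ae_eq_fourier_toLp h1 h2)]
    have := congrArg (fun x ↦ ENNReal.ofReal x) (Lp.norm_fourier_eq (h2.toLp h))
    simp only [ofReal_norm] at this
    rw [Lp.enorm_def, Lp.enorm_def, eLpNorm_congr_ae h2.coeFn_toLp] at this
    rw [this]
  · have : eLpNorm h 2 volume = ∞ := by
      by_contra hne
      exact h2 ⟨h1.1, lt_top_iff_ne_top.2 hne⟩
    simp [key h, this]

theorem lintegral_comp_mul_left_real (φ : ℝ → ℝ≥0∞) {a : ℝ} (ha : a ≠ 0) :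
    ∫⁻ t, φ (a * t) = ENNReal.ofReal |a⁻¹| * ∫⁻ t, φ t := by
  have := (MeasurableEquiv.mulLeft₀ a ha).measurableEmbedding.lintegral_map (μ := volume) φ
  rw [MeasurableEquiv.coe_mulLeft₀, Real.map_volume_mul_left ha, lintegral_smul_measure] at this
  exact this.symm

theorem integral_cexp_mul_eq_fourier (h : ℝ → ℂ) (x : ℝ) :
    ∫ r : ℝ, Complex.exp (Complex.I * ((x * r : ℝ) : ℂ)) * h r = 𝓕 h (-(2 * π)⁻¹ * x) := by
  rw [Real.fourier_real_eq_integral_exp_smul]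
  refine integral_congr_ae (.of_forall fun r ↦ ?_)
  simp only [smul_eq_mul]
  congr 2
  rw [mul_comm]
  congr 2
  field_simp

theorem lintegral_enorm_integral_cexp_mul_sq_le {h : ℝ → ℂ} (h1 : Integrable h) {a : ℝ}
    (ha : a ≠ 0) :
    ∫⁻ t : ℝ, ‖∫ r : ℝ, Complex.exp (Complex.I * ((a * t * r : ℝ) : ℂ)) * h r‖ₑ ^ 2 ≤
      ENNReal.ofReal (2 * π / |a|) * ∫⁻ r, ‖h r‖ₑ ^ 2 := by
  have hpi := Real.pi_pos
  simp_rw [integral_cexp_mul_eq_fourier, ← mul_assoc]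
  rw [lintegral_comp_mul_left_real (fun w ↦ ‖𝓕 h w‖ₑ ^ 2) (by simp [ha, hpi.ne'])]
  have : |(-(2 * π)⁻¹ * a)⁻¹| = 2 * π / |a| := by
    rw [abs_inv, abs_mul, abs_neg, abs_inv, abs_of_pos (by positivity : 0 < 2 * π), mul_inv,
      inv_inv, div_eq_mul_inv]
  rw [this]
  exact mul_le_mul_right (lintegral_enorm_fourier_sq_le h1) _

/-- Local smoothing on a half-line: Plancherel in time after the substitution `r = s ^ 2`. -/
theorem lintegral_enorm_integral_Ioi_cexp_sq_le {K : ℝ → ℂ} (hK : Integrable K) {δ : ℝ}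
    (hδ : 0 < δ) (hKδ : ∀ s, 0 < s → s < δ → K s = 0) :
    ∫⁻ t : ℝ, ‖∫ s in Set.Ioi 0, Complex.exp (Complex.I * ((-2 * t * s ^ 2 : ℝ) : ℂ)) * K s‖ₑ ^ 2 ≤
      ENNReal.ofReal (π / (2 * δ)) * ∫⁻ s in Set.Ioi 0, ‖K s‖ₑ ^ 2 := by
  have himg : (fun s : ℝ ↦ s ^ 2) '' Set.Ioi 0 = Set.Ioi 0 := by
    ext r
    constructor
    · rintro ⟨s, hs, rfl⟩
      exact pow_pos (Set.mem_Ioi.1 hs) 2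
    · intro hr
      exact ⟨√r, Real.sqrt_pos.2 hr, Real.sq_sqrt (le_of_lt hr)⟩
  have hderiv : ∀ s ∈ Set.Ioi (0 : ℝ),
      HasDerivWithinAt (fun s : ℝ ↦ s ^ 2) (2 * s) (Set.Ioi 0) s := fun s _ ↦ by
    simpa using (hasDerivAt_pow 2 s).hasDerivWithinAt
  have hinj : Set.InjOn (fun s : ℝ ↦ s ^ 2) (Set.Ioi 0) := fun x hx y hy hxy ↦
    (pow_left_inj₀ (le_of_lt hx) (le_of_lt hy) two_ne_zero).1 hxy
  set k : ℝ → ℂ := fun r ↦ ((2 * √r : ℝ) : ℂ)⁻¹ * K (√r) with hk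
  have hks {s : ℝ} (hs : s ∈ Set.Ioi (0 : ℝ)) : k (s ^ 2) = ((2 * s : ℝ) : ℂ)⁻¹ * K s := by
    simp only [hk, Real.sqrt_sq (le_of_lt hs)]
  have habs {s : ℝ} (hs : s ∈ Set.Ioi (0 : ℝ)) : |2 * s| = 2 * s :=
    abs_of_pos (mul_pos two_pos hs)
  have hcancel {s : ℝ} (hs : s ∈ Set.Ioi (0 : ℝ)) (c : ℂ) :
      |2 * s| • (c * k (s ^ 2)) = c * K s := by
    have : ((2 * s : ℝ) : ℂ) ≠ 0 := by
      exact_mod_cast (mul_pos two_pos hs).ne'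
    rw [habs hs, hks hs, Complex.real_smul]
    field_simp
  have hkint : IntegrableOn k (Set.Ioi 0) := by
    rw [← himg, integrableOn_image_iff_integrableOn_abs_deriv_smul measurableSet_Ioi hderiv hinj]
    refine (hK.integrableOn (s := Set.Ioi 0)).congr_fun (fun s hs ↦ ?_) measurableSet_Ioi
    simpa using (hcancel hs 1).symm
  have hint (t : ℝ) :
      ∫ s in Set.Ioi 0, Complex.exp (Complex.I * ((-2 * t * s ^ 2 : ℝ) : ℂ)) * K s =
      ∫ r, Complex.exp (Complex.I * ((-2 * t * r : ℝ) : ℂ)) * (Set.Ioi 0).indicator k r := by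
    have := integral_image_eq_integral_abs_deriv_smul measurableSet_Ioi hderiv hinj
      (fun r ↦ Complex.exp (Complex.I * ((-2 * t * r : ℝ) : ℂ)) * k r)
    rw [himg, ← integral_indicator measurableSet_Ioi] at this
    simp only [Set.indicator_mul_right] at this
    rw [this]
    exact setIntegral_congr_fun measurableSet_Ioi fun s hs ↦ (hcancel hs _).symm
  have hsq : ∫⁻ r, ‖(Set.Ioi 0).indicator k r‖ₑ ^ 2 ≤
      ENNReal.ofReal (1 / (2 * δ)) * ∫⁻ s in Set.Ioi 0, ‖K s‖ₑ ^ 2 := by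
    have e : ∀ r, ‖(Set.Ioi 0).indicator k r‖ₑ ^ 2 =
        (Set.Ioi 0).indicator (fun r ↦ ‖k r‖ₑ ^ 2) r := fun r ↦ by
      by_cases hr : r ∈ Set.Ioi (0 : ℝ) <;> simp [hr, -Set.mem_Ioi]
    simp_rw [e]
    have := lintegral_image_eq_lintegral_abs_deriv_mul measurableSet_Ioi hderiv hinj
      (fun r ↦ ‖k r‖ₑ ^ 2)
    rw [himg] at this
    rw [lintegral_indicator measurableSet_Ioi, this, ← lintegral_const_mul' _ _ ENNReal.ofReal_ne_top]
    refine setLIntegral_mono' measurableSet_Ioi fun s hs ↦ ?_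
    rw [hks hs, habs hs]
    rcases lt_or_ge s δ with hlt | hge
    · simp [hKδ s hs hlt]
    · have h2s : 0 < 2 * s := mul_pos two_pos hs
      rw [enorm_mul, mul_pow, ← mul_assoc]
      gcongr
      rw [← Complex.ofReal_inv, ← ofReal_norm, Complex.norm_real, Real.norm_of_nonneg (by positivity),
        ← ENNReal.ofReal_pow (by positivity), ← ENNReal.ofReal_mul h2s.le]
      refine ENNReal.ofReal_le_ofReal ?_
      have : 2 * s * (2 * s)⁻¹ ^ 2 = 1 / (2 * s) := by field_simp
      rw [this]
      gcongr
  simp_rw [hint]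
  refine (lintegral_enorm_integral_cexp_mul_sq_le (hkint.integrable_indicator measurableSet_Ioi)
    (by norm_num : (-2 : ℝ) ≠ 0)).trans ?_
  refine (mul_le_mul_right hsq _).trans ?_
  rw [← mul_assoc, ← ENNReal.ofReal_mul (by positivity)]
  gcongr
  rw [abs_of_neg (by norm_num : (-2 : ℝ) < 0)]
  apply le_of_eq
  field_simp

/-- Local smoothing on the line, for amplitudes vanishing near the stationary frequency. -/
theorem lintegral_enorm_integral_cexp_sq_le {K : ℝ → ℂ} (hK : Continuous K)
    (hKc : HasCompactSupport K) {δ : ℝ} (hδ : 0 < δ) (hKδ : ∀ s, |s| < δ → K s = 0) :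
    ∫⁻ t : ℝ, ‖∫ s, Complex.exp (Complex.I * ((-2 * t * s ^ 2 : ℝ) : ℂ)) * K s‖ₑ ^ 2 ≤
      ENNReal.ofReal (π / δ) * ∫⁻ s, ‖K s‖ₑ ^ 2 := by
  have hKint : Integrable K := hK.integrable_of_hasCompactSupport hKc
  set A : ℝ → ℂ := fun t ↦
    ∫ s in Set.Ioi 0, Complex.exp (Complex.I * ((-2 * t * s ^ 2 : ℝ) : ℂ)) * K s
  set B : ℝ → ℂ := fun t ↦
    ∫ s in Set.Ioi 0, Complex.exp (Complex.I * ((-2 * t * s ^ 2 : ℝ) : ℂ)) * K (-s)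
  have hsplit (t : ℝ) :
      ∫ s, Complex.exp (Complex.I * ((-2 * t * s ^ 2 : ℝ) : ℂ)) * K s = A t + B t := by
    have hint : Integrable fun s ↦ Complex.exp (Complex.I * ((-2 * t * s ^ 2 : ℝ) : ℂ)) * K s :=
      Continuous.integrable_of_hasCompactSupport (by fun_prop) hKc.mul_left
    have hneg := integral_comp_neg_Ioi 0
      fun s ↦ Complex.exp (Complex.I * ((-2 * t * s ^ 2 : ℝ) : ℂ)) * K s
    simp only [neg_sq, neg_zero] at hneg
    rw [← intervalIntegral.integral_Iic_add_Ioi hint.integrableOn hint.integrableOn (b := 0),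
      ← hneg, add_comm]
  have hAm : Measurable A := (StronglyMeasurable.integral_prod_right
    (Continuous.stronglyMeasurable (by fun_prop))).measurable
  have hA_le := lintegral_enorm_integral_Ioi_cexp_sq_le hKint hδ
    fun s h0 hs ↦ hKδ s (by rwa [abs_of_pos h0])
  have hB_le := lintegral_enorm_integral_Ioi_cexp_sq_le hKint.comp_neg hδ
    fun s h0 hs ↦ hKδ (-s) (by rwa [abs_neg, abs_of_pos h0])
  have hpt (t : ℝ) : ‖A t + B t‖ₑ ^ 2 ≤ 2 * (‖A t‖ₑ ^ 2 + ‖B t‖ₑ ^ 2) := by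
    refine (pow_le_pow_left' (enorm_add_le _ _) 2).trans ?_
    have := ENNReal.rpow_add_le_mul_rpow_add_rpow ‖A t‖ₑ ‖B t‖ₑ (one_le_two : (1 : ℝ) ≤ 2)
    norm_num at this
    exact this
  have hsum : ∫⁻ s, ‖K s‖ₑ ^ 2 =
      (∫⁻ s in Set.Ioi 0, ‖K s‖ₑ ^ 2) + ∫⁻ s in Set.Ioi 0, ‖K (-s)‖ₑ ^ 2 := by
    have hneg := (Measure.measurePreserving_neg (volume : Measure ℝ)).setLIntegral_comp_preimage_emb
      (MeasurableEquiv.neg ℝ).measurableEmbedding (fun s ↦ ‖K s‖ₑ ^ 2) (Set.Iio 0)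
    simp only [Set.neg_preimage, Set.neg_Iio, neg_zero] at hneg
    rw [hneg, ← lintegral_add_compl _ (measurableSet_Ioi (a := (0 : ℝ))), Set.compl_Ioi,
      setLIntegral_congr Iio_ae_eq_Iic.symm]
  simp_rw [hsplit]
  calc ∫⁻ t, ‖A t + B t‖ₑ ^ 2
      ≤ ∫⁻ t, 2 * (‖A t‖ₑ ^ 2 + ‖B t‖ₑ ^ 2) := lintegral_mono hpt
    _ = 2 * ((∫⁻ t, ‖A t‖ₑ ^ 2) + ∫⁻ t, ‖B t‖ₑ ^ 2) := by
      rw [lintegral_const_mul' _ _ (by norm_num), lintegral_add_left (by fun_prop)]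
    _ ≤ 2 * (ENNReal.ofReal (π / (2 * δ)) * ∫⁻ s, ‖K s‖ₑ ^ 2) := by
      rw [hsum, mul_add (ENNReal.ofReal _)]
      exact mul_le_mul_right (add_le_add hA_le hB_le) _
    _ = ENNReal.ofReal (π / δ) * ∫⁻ s, ‖K s‖ₑ ^ 2 := by
      rw [← mul_assoc, ← ENNReal.ofReal_ofNat 2, ← ENNReal.ofReal_mul (by norm_num)]
      congr 2
      field_simp

open Convolution in
/-- Plancherel in the space variable, at a fixed time. -/
theorem lintegral_enorm_schrodinger_mul_sq_le {f g : ℝ → ℂ} (hf : Continuous f)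
    (hg : Continuous g) (hfc : HasCompactSupport f) (hgc : HasCompactSupport g) (t : ℝ) :
    ∫⁻ x : ℝ, ‖(∫ η : ℝ, Complex.exp (Complex.I * ((x * η - t * η ^ 2 : ℝ) : ℂ)) * f η) *
        (∫ η : ℝ, Complex.exp (Complex.I * ((x * η - t * η ^ 2 : ℝ) : ℂ)) * g η)‖ₑ ^ 2 ≤
      ENNReal.ofReal (2 * π) * ∫⁻ ξ : ℝ, ‖∫ s : ℝ,
        Complex.exp (Complex.I * ((-2 * t * s ^ 2 : ℝ) : ℂ)) *
          (f (ξ / 2 + s) * g (ξ / 2 - s))‖ₑ ^ 2 := by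
  set E : ℝ → ℂ := fun η ↦ Complex.exp (Complex.I * ((-(t * η ^ 2) : ℝ) : ℂ)) with hE
  have hEc : Continuous E := by fun_prop
  have hF : Integrable fun η ↦ E η * f η :=
    (hEc.mul hf).integrable_of_hasCompactSupport hfc.mul_left
  have hG : Integrable fun η ↦ E η * g η :=
    (hEc.mul hg).integrable_of_hasCompactSupport hgc.mul_left
  have hphase (x : ℝ) (h : ℝ → ℂ) :
      ∫ η : ℝ, Complex.exp (Complex.I * ((x * η - t * η ^ 2 : ℝ) : ℂ)) * h η =
        𝓕 (fun η ↦ E η * h η) (-(2 * π)⁻¹ * x) := by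
    rw [← integral_cexp_mul_eq_fourier]
    refine integral_congr_ae (.of_forall fun η ↦ ?_)
    simp only [hE, ← mul_assoc, ← Complex.exp_add]
    congr 2
    push_cast
    ring
  have hconv (ξ : ℝ) :
      ‖((fun η ↦ E η * f η) ⋆[ContinuousLinearMap.mul ℂ ℂ] fun η ↦ E η * g η) ξ‖ₑ =
        ‖∫ s : ℝ, Complex.exp (Complex.I * ((-2 * t * s ^ 2 : ℝ) : ℂ)) *
          (f (ξ / 2 + s) * g (ξ / 2 - s))‖ₑ := by
    have : ((fun η ↦ E η * f η) ⋆[ContinuousLinearMap.mul ℂ ℂ] fun η ↦ E η * g η) ξ =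
        Complex.exp (Complex.I * ((-(t * ξ ^ 2 / 2) : ℝ) : ℂ)) *
        ∫ s : ℝ, Complex.exp (Complex.I * ((-2 * t * s ^ 2 : ℝ) : ℂ)) *
          (f (ξ / 2 + s) * g (ξ / 2 - s)) := by
      rw [convolution_def, ← integral_add_left_eq_self _ (ξ / 2), ← integral_const_mul]
      refine integral_congr_ae (.of_forall fun s ↦ ?_)
      have hs : ξ - (ξ / 2 + s) = ξ / 2 - s := by ring
      simp only [ContinuousLinearMap.mul_apply', hs, hE]
      rw [mul_mul_mul_comm, ← mul_assoc (Complex.exp (Complex.I * ((-(t * ξ ^ 2 / 2) : ℝ) : ℂ))),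
        ← Complex.exp_add, ← Complex.exp_add]
      congr 2
      push_cast
      ring
    rw [this, enorm_mul, ← ofReal_norm (Complex.exp _), mul_comm Complex.I,
      Complex.norm_exp_ofReal_mul_I, ENNReal.ofReal_one, one_mul]
  have hcint := hF.integrable_convolution (ContinuousLinearMap.mul ℂ ℂ) hG
  have := lintegral_enorm_integral_cexp_mul_sq_le hcint one_ne_zero
  simp_rw [hconv, integral_cexp_mul_eq_fourier, one_mul,
    Real.fourier_mul_convolution_eq hF hG, abs_one, div_one] at this
  simp_rw [hphase]
  exact this

theorem lintegral_lintegral_enorm_mul_sq {f g : ℝ → ℂ} (hf : Continuous f) (hg : Continuous g) :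
    ∫⁻ ξ : ℝ, ∫⁻ s : ℝ, ‖f (ξ / 2 + s) * g (ξ / 2 - s)‖ₑ ^ 2 =
      (∫⁻ η, ‖f η‖ₑ ^ 2) * ∫⁻ η, ‖g η‖ₑ ^ 2 := by
  have h1 (ξ : ℝ) : ∫⁻ s : ℝ, ‖f (ξ / 2 + s) * g (ξ / 2 - s)‖ₑ ^ 2 =
      ∫⁻ η : ℝ, ‖f η‖ₑ ^ 2 * ‖g (ξ - η)‖ₑ ^ 2 := by
    rw [← lintegral_add_left_eq_self (fun η ↦ ‖f η‖ₑ ^ 2 * ‖g (ξ - η)‖ₑ ^ 2) (ξ / 2)]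
    refine lintegral_congr fun s ↦ ?_
    rw [enorm_mul, mul_pow, show ξ - (ξ / 2 + s) = ξ / 2 - s by ring]
  simp_rw [h1]
  rw [lintegral_lintegral_swap (by
    refine Measurable.aemeasurable ?_
    simp only [Function.uncurry_def]
    fun_prop)]
  rw [← lintegral_mul_const _ (by fun_prop)]
  refine lintegral_congr fun η ↦ ?_
  have hgm : Measurable fun ξ ↦ ‖g (ξ - η)‖ₑ ^ 2 := Continuous.measurable (by fun_prop)
  rw [lintegral_const_mul _ hgm, lintegral_sub_right_eq_self (fun ξ ↦ ‖g ξ‖ₑ ^ 2)]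

/-- **1D bilinear smoothing for frequency-separated Schrödinger waves**: there is a
universal `C > 0` such that if the (compact) frequency supports of `f` and `g` are
separated by `μ > 0`, then the product of the two free Schrödinger waves satisfies
`‖u v‖²_{L²_{t,x}} ≤ (C/μ) ‖f‖²_{L²} ‖g‖²_{L²}`. -/
theorem bilinear_smoothing_schrodinger_1d :
    ∃ C : ℝ, 0 < C ∧
      ∀ (f g : ℝ → ℂ), Continuous f → Continuous g →
        HasCompactSupport f → HasCompactSupport g →
        ∀ (μ : ℝ), 0 < μ →
        (∀ η ∈ Function.support f, ∀ lam ∈ Function.support g, μ ≤ |η - lam|) →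
        (∫⁻ p : ℝ × ℝ,
            (‖(∫ η : ℝ, Complex.exp (Complex.I * ((p.2 * η - p.1 * η ^ 2 : ℝ) : ℂ)) * f η) *
              (∫ lam : ℝ, Complex.exp (Complex.I * ((p.2 * lam - p.1 * lam ^ 2 : ℝ) : ℂ)) * g lam)‖₊ :
              ℝ≥0∞) ^ (2 : ℕ) ∂(volume : Measure (ℝ × ℝ)))
          ≤ ENNReal.ofReal (C / μ) *
            eLpNorm f 2 (volume : Measure ℝ) ^ (2 : ℕ) *
            eLpNorm g 2 (volume : Measure ℝ) ^ (2 : ℕ) := by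
  refine ⟨4 * π ^ 2, by positivity, fun f g hf hg hfc hgc μ hμ hsep ↦ ?_⟩
  have hnorm (k : ℝ → ℂ) : eLpNorm k 2 volume ^ 2 = ∫⁻ x, ‖k x‖ₑ ^ 2 := by
    simpa using eLpNorm_nnreal_pow_eq_lintegral (f := k) (μ := volume) (p := 2) (by norm_num)
  have hG (ξ : ℝ) : ∫⁻ t : ℝ, ‖∫ s : ℝ, Complex.exp (Complex.I * ((-2 * t * s ^ 2 : ℝ) : ℂ)) *
        (f (ξ / 2 + s) * g (ξ / 2 - s))‖ₑ ^ 2 ≤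
      ENNReal.ofReal (π / (μ / 2)) * ∫⁻ s, ‖f (ξ / 2 + s) * g (ξ / 2 - s)‖ₑ ^ 2 := by
    refine lintegral_enorm_integral_cexp_sq_le (by fun_prop)
      (hfc.comp_homeomorph (Homeomorph.addLeft (ξ / 2))).mul_right (by positivity) fun s hs ↦ ?_
    by_contra hne
    have : μ ≤ |ξ / 2 + s - (ξ / 2 - s)| :=
      hsep _ (left_ne_zero_of_mul hne) _ (right_ne_zero_of_mul hne)
    rw [show ξ / 2 + s - (ξ / 2 - s) = 2 * s by ring, abs_mul, abs_two] at this
    linarith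
  rw [hnorm, hnorm, Measure.volume_eq_prod]
  simp_rw [← enorm_eq_nnnorm]
  calc _ ≤ _ := lintegral_prod_le _
    _ ≤ ∫⁻ t : ℝ, ENNReal.ofReal (2 * π) * ∫⁻ ξ : ℝ, ‖∫ s : ℝ,
        Complex.exp (Complex.I * ((-2 * t * s ^ 2 : ℝ) : ℂ)) *
          (f (ξ / 2 + s) * g (ξ / 2 - s))‖ₑ ^ 2 :=
      lintegral_mono fun t ↦ lintegral_enorm_schrodinger_mul_sq_le hf hg hfc hgc t
    _ = ENNReal.ofReal (2 * π) * ∫⁻ ξ : ℝ, ∫⁻ t : ℝ, ‖∫ s : ℝ,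
        Complex.exp (Complex.I * ((-2 * t * s ^ 2 : ℝ) : ℂ)) *
          (f (ξ / 2 + s) * g (ξ / 2 - s))‖ₑ ^ 2 := by
      rw [lintegral_const_mul' _ _ ENNReal.ofReal_ne_top, lintegral_lintegral_swap]
      refine Measurable.aemeasurable (Measurable.pow_const (Measurable.enorm ?_) 2)
      exact (StronglyMeasurable.integral_prod_right
        (f := fun (p : ℝ × ℝ) (s : ℝ) ↦
          Complex.exp (Complex.I * ((-2 * p.1 * s ^ 2 : ℝ) : ℂ)) *
            (f (p.2 / 2 + s) * g (p.2 / 2 - s)))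
        (Continuous.stronglyMeasurable (by fun_prop))).measurable
    _ ≤ ENNReal.ofReal (2 * π) * ∫⁻ ξ : ℝ, ENNReal.ofReal (π / (μ / 2)) *
        ∫⁻ s, ‖f (ξ / 2 + s) * g (ξ / 2 - s)‖ₑ ^ 2 := by
      exact mul_le_mul_right (lintegral_mono hG) _
    _ = ENNReal.ofReal (4 * π ^ 2 / μ) * (∫⁻ η, ‖f η‖ₑ ^ 2) * ∫⁻ η, ‖g η‖ₑ ^ 2 := by
      rw [lintegral_const_mul' _ _ ENNReal.ofReal_ne_top, lintegral_lintegral_enorm_mul_sq hf hg,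
        ← mul_assoc, ← ENNReal.ofReal_mul (by positivity), mul_assoc (ENNReal.ofReal _)]
      congr 2
      field_simp
      norm_num

end
end

section
/- There exists C > 0 such that for all signs ± , all j, j', j'', k, k', k'' ∈ ℕ, and all Schwartz functions u, v on ℝ² with supp 𝓕u ⊆ R^+_{jk} and supp 𝓕v ⊆ R^±_{j'k'}, one has ‖ 1_{R^+_{j''k''}} · 𝓕(u v) ‖_{L²(ℝ²)} ≤ C 2^{(j♭ + k♭)/2} ‖u‖_{L²(ℝ²)} ‖v‖_{L²(ℝ²)}, where j♭ = min(j, j', j'') and k♭ = min(k, k', k''). -/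
open MeasureTheory SchwartzMap
open scoped ENNReal NNReal

noncomputable section

/-- Space–time Fourier transform on `ℝ²`, `(t,x) ↦ (τ,ξ)`. -/
def FT2 (u : ℝ × ℝ → ℂ) (q : ℝ × ℝ) : ℂ :=
  ∫ p : ℝ × ℝ,
    Complex.exp (-(2 * Real.pi * Complex.I) * ((p.1 * q.1 + p.2 * q.2 : ℝ) : ℂ)) * u p

/-- The dyadic space–time block `R^±_{jk}` (sign `ε = ±1`): spatial frequency
`2^{j-1} ≤ ε ξ ≤ 2^{j+1}` and modulation `2^{k-1} ≤ |τ - ε ξ²| ≤ 2^{k+1}`. -/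
def Rblock (ε : ℝ) (j k : ℕ) : Set (ℝ × ℝ) :=
  {q : ℝ × ℝ |
    (2 : ℝ) ^ ((j : ℝ) - 1) ≤ ε * q.2 ∧ ε * q.2 ≤ (2 : ℝ) ^ ((j : ℝ) + 1) ∧
    (2 : ℝ) ^ ((k : ℝ) - 1) ≤ |q.1 - ε * q.2 ^ 2| ∧
    |q.1 - ε * q.2 ^ 2| ≤ (2 : ℝ) ^ ((k : ℝ) + 1)}

/-- Minimum of a triple. -/
def min3 (a b c : ℕ) : ℕ := min a (min b c)

/-- Maximum of a triple. -/
def max3 (a b c : ℕ) : ℕ := max a (max b c)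

/-- Median of a triple. -/
def med3 (a b c : ℕ) : ℕ := a + b + c - min3 a b c - max3 a b c

open scoped FourierTransform

/-- Cauchy–Schwarz inequality for lower Lebesgue integrals, in squared form. -/
theorem sq_lintegral_mul_le {α : Type*} [MeasurableSpace α] {μ : Measure α} {f g : α → ℝ≥0∞}
    (hf : AEMeasurable f μ) (hg : AEMeasurable g μ) :
    (∫⁻ a, f a * g a ∂μ) ^ 2 ≤ (∫⁻ a, f a ^ 2 ∂μ) * ∫⁻ a, g a ^ 2 ∂μ := by
  have h := ENNReal.lintegral_mul_le_Lp_mul_Lq μ Real.HolderConjugate.two_two hf hg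
  simp only [Pi.mul_apply, ENNReal.rpow_two] at h
  calc (∫⁻ a, f a * g a ∂μ) ^ 2
      ≤ ((∫⁻ a, f a ^ 2 ∂μ) ^ (1 / 2 : ℝ) * (∫⁻ a, g a ^ 2 ∂μ) ^ (1 / 2 : ℝ)) ^ 2 := by gcongr
    _ = _ := by
      rw [mul_pow, ← ENNReal.rpow_two, ← ENNReal.rpow_two, ← ENNReal.rpow_mul,
        ← ENNReal.rpow_mul]
      norm_num

/-- A trilinear integral is controlled by `L²` norms and the measure of the fibres on which the
two inner factors do not vanish. -/
theorem sq_lintegral_trilinear_le {α : Type*} [MeasurableSpace α] {μ : Measure α} [SFinite μ]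
    {X Y Z : α → ℝ≥0∞} (hX : Measurable X) (hY : Measurable Y) (hZ : Measurable Z)
    {φ : α → α → α} (hφ : Measurable (Function.uncurry φ))
    (hYφ : ∀ p, ∫⁻ z, Y (φ z p) ^ 2 ∂μ = ∫⁻ q, Y q ^ 2 ∂μ)
    {M : ℝ≥0∞} (hM : ∀ z, μ {p | X p ≠ 0 ∧ Y (φ z p) ≠ 0} ≤ M) :
    (∫⁻ z, Z z * ∫⁻ p, X p * Y (φ z p) ∂μ ∂μ) ^ 2 ≤
      M * (∫⁻ z, Z z ^ 2 ∂μ) * (∫⁻ p, X p ^ 2 ∂μ) * ∫⁻ q, Y q ^ 2 ∂μ := by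
  have hYφm : Measurable fun q : α × α => Y (φ q.1 q.2) := hY.comp hφ
  have hXYm : Measurable fun q : α × α => X q.2 * Y (φ q.1 q.2) :=
    (hX.comp measurable_snd).mul hYφm
  have inner_le (z : α) : (∫⁻ p, X p * Y (φ z p) ∂μ) ^ 2 ≤
      M * ∫⁻ p, X p ^ 2 * Y (φ z p) ^ 2 ∂μ := by
    have hm : Measurable fun p => X p * Y (φ z p) := hXYm.comp measurable_prodMk_left
    have hYz : Measurable fun p => Y (φ z p) := hYφm.comp measurable_prodMk_left
    set S : Set α := {p | X p ≠ 0 ∧ Y (φ z p) ≠ 0}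
    have hS : MeasurableSet S :=
      (measurableSet_eq_fun hX measurable_const).compl.inter
        (measurableSet_eq_fun hYz measurable_const).compl
    have key : ∀ p, X p * Y (φ z p) = S.indicator 1 p * (X p * Y (φ z p)) := by
      intro p
      by_cases hp : p ∈ S
      · simp [hp]
      · have : X p * Y (φ z p) = 0 := by
          by_contra h
          exact hp ⟨left_ne_zero_of_mul h, right_ne_zero_of_mul h⟩
        simp [this]
    calc (∫⁻ p, X p * Y (φ z p) ∂μ) ^ 2
        = (∫⁻ p, S.indicator 1 p * (X p * Y (φ z p)) ∂μ) ^ 2 := by simp_rw [← key]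
      _ ≤ (∫⁻ p, S.indicator (1 : α → ℝ≥0∞) p ^ 2 ∂μ) * ∫⁻ p, (X p * Y (φ z p)) ^ 2 ∂μ :=
          sq_lintegral_mul_le ((measurable_one.indicator hS).aemeasurable) hm.aemeasurable
      _ = μ S * ∫⁻ p, X p ^ 2 * Y (φ z p) ^ 2 ∂μ := by
          congr 1
          · rw [← lintegral_indicator_one hS]
            congr 1 with p
            by_cases hp : p ∈ S <;> simp [hp]
          · simp_rw [mul_pow]
      _ ≤ _ := by gcongr; exact hM z
  have hsq : Measurable fun q : α × α => X q.2 ^ 2 * Y (φ q.1 q.2) ^ 2 :=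
    ((hX.comp measurable_snd).pow_const 2).mul (hYφm.pow_const 2)
  calc (∫⁻ z, Z z * ∫⁻ p, X p * Y (φ z p) ∂μ ∂μ) ^ 2
      ≤ (∫⁻ z, Z z ^ 2 ∂μ) * ∫⁻ z, (∫⁻ p, X p * Y (φ z p) ∂μ) ^ 2 ∂μ :=
        sq_lintegral_mul_le hZ.aemeasurable hXYm.lintegral_prod_right'.aemeasurable
    _ ≤ (∫⁻ z, Z z ^ 2 ∂μ) * ∫⁻ z, M * ∫⁻ p, X p ^ 2 * Y (φ z p) ^ 2 ∂μ ∂μ := by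
        gcongr with z
        exact inner_le z
    _ = (∫⁻ z, Z z ^ 2 ∂μ) * (M * ∫⁻ p, ∫⁻ z, X p ^ 2 * Y (φ z p) ^ 2 ∂μ ∂μ) := by
        rw [lintegral_const_mul _ hsq.lintegral_prod_right',
          lintegral_lintegral_swap hsq.aemeasurable]
    _ = (∫⁻ z, Z z ^ 2 ∂μ) * (M * ∫⁻ p, X p ^ 2 * ∫⁻ q, Y q ^ 2 ∂μ ∂μ) := by
        congr 3 with p
        have hYp : Measurable fun z => Y (φ z p) := hYφm.comp measurable_prodMk_right
        rw [lintegral_const_mul _ (hYp.pow_const 2), hYφ p]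
    _ = _ := by
        rw [lintegral_mul_const _ (hX.pow_const 2)]
        ring

/-- If `W` is dominated by the convolution of `F` and `G`, and for one of the three pairs among
`F`, `G`, `W` the fibres of the joint support have measure at most `M`, then
`‖W‖₂² ≤ M ‖F‖₂² ‖G‖₂²`. -/
theorem lintegral_sq_le_of_le_convolution {E : Type*} [AddCommGroup E] [MeasurableSpace E]
    [MeasurableAdd₂ E] [MeasurableNeg E] {μ : Measure E} [SFinite μ] [μ.IsAddLeftInvariant]
    [μ.IsNegInvariant] {F G W : E → ℝ≥0∞}
    (hF : Measurable F) (hG : Measurable G) (hW : Measurable W)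
    (hWle : ∀ q, W q ≤ ∫⁻ p, F p * G (q - p) ∂μ) (hWtop : ∫⁻ q, W q ^ 2 ∂μ ≠ ∞) {M : ℝ≥0∞}
    (hM : (∀ z, μ {p | F p ≠ 0 ∧ G (z - p) ≠ 0} ≤ M) ∨
      (∀ z, μ {p | W p ≠ 0 ∧ G (p - z) ≠ 0} ≤ M) ∨
      (∀ z, μ {p | W p ≠ 0 ∧ F (p - z) ≠ 0} ≤ M)) :
    ∫⁻ q, W q ^ 2 ∂μ ≤ M * (∫⁻ p, F p ^ 2 ∂μ) * ∫⁻ p, G p ^ 2 ∂μ := by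
  have hsub : Measurable (Function.uncurry fun z p : E => z - p) :=
    measurable_fst.sub measurable_snd
  have hsub' : Measurable (Function.uncurry fun z p : E => p - z) :=
    measurable_snd.sub measurable_fst
  have hright (Y : E → ℝ≥0∞) (p : E) : ∫⁻ z, Y (z - p) ^ 2 ∂μ = ∫⁻ q, Y q ^ 2 ∂μ :=
    lintegral_sub_right_eq_self (fun q => Y q ^ 2) p
  have hleft (Y : E → ℝ≥0∞) (p : E) : ∫⁻ z, Y (p - z) ^ 2 ∂μ = ∫⁻ q, Y q ^ 2 ∂μ :=
    lintegral_sub_left_eq_self (fun q => Y q ^ 2) p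
  set T := ∫⁻ q, W q * ∫⁻ p, F p * G (q - p) ∂μ ∂μ with hT
  have hWT : ∫⁻ q, W q ^ 2 ∂μ ≤ T := by
    refine lintegral_mono fun q => ?_
    rw [sq]
    gcongr
    exact hWle q
  have swap {A B : E → ℝ≥0∞} (hA : Measurable A) (hB : Measurable B) :
      ∫⁻ q, W q * ∫⁻ p, A p * B (q - p) ∂μ ∂μ = ∫⁻ p, A p * ∫⁻ q, W q * B (q - p) ∂μ ∂μ := by
    have hBm : Measurable fun q : E × E => B (q.1 - q.2) := hB.comp hsub
    have hm : Measurable fun q : E × E => W q.1 * (A q.2 * B (q.1 - q.2)) :=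
      (hW.comp measurable_fst).mul ((hA.comp measurable_snd).mul hBm)
    calc _ = ∫⁻ q, ∫⁻ p, W q * (A p * B (q - p)) ∂μ ∂μ := by
          congr 1 with q
          exact (lintegral_const_mul _ (hA.mul (hBm.comp measurable_prodMk_left))).symm
      _ = ∫⁻ p, ∫⁻ q, W q * (A p * B (q - p)) ∂μ ∂μ := lintegral_lintegral_swap hm.aemeasurable
      _ = _ := by
          congr 1 with p
          simp_rw [mul_left_comm (W _)]
          exact lintegral_const_mul _ (hW.mul (hBm.comp measurable_prodMk_right))
  have hTcomm : T = ∫⁻ q, W q * ∫⁻ p, G p * F (q - p) ∂μ ∂μ := by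
    rw [hT]
    congr 1 with q
    rw [← lintegral_sub_left_eq_self _ q]
    simp [mul_comm]
  have hTsq : T ^ 2 ≤
      (∫⁻ q, W q ^ 2 ∂μ) * (M * (∫⁻ p, F p ^ 2 ∂μ) * ∫⁻ p, G p ^ 2 ∂μ) := by
    rcases hM with hM | hM | hM
    · refine (sq_lintegral_trilinear_le hF hG hW hsub (hright G) hM).trans_eq ?_
      ring
    · rw [hT, swap hF hG]
      refine (sq_lintegral_trilinear_le hW hG hF hsub' (hleft G) hM).trans_eq ?_
      ring
    · rw [hTcomm, swap hG hF]
      refine (sq_lintegral_trilinear_le hW hF hG hsub' (hleft F) hM).trans_eq ?_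
      ring
  rcases eq_or_ne (∫⁻ q, W q ^ 2 ∂μ) 0 with h0 | h0
  · simp [h0]
  · refine (ENNReal.mul_le_mul_iff_right h0 hWtop).mp ?_
    calc _ = (∫⁻ q, W q ^ 2 ∂μ) ^ 2 := (sq _).symm
      _ ≤ T ^ 2 := by gcongr
      _ ≤ _ := hTsq

/-- Volume bound for a strip of half-width `b` around a graph over an interval of half-length
`a`. -/
theorem volume_strip_le {f : ℝ → ℝ} (hf : Measurable f) (a b c : ℝ) :
    volume {p : ℝ × ℝ | |p.2 - c| ≤ a ∧ |p.1 - f p.2| ≤ b} ≤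
      ENNReal.ofReal (2 * a) * ENNReal.ofReal (2 * b) := by
  have hS : MeasurableSet {p : ℝ × ℝ | |p.2 - c| ≤ a ∧ |p.1 - f p.2| ≤ b} := by
    measurability
  rw [Measure.volume_eq_prod, Measure.prod_apply_symm hS]
  calc _ ≤ ∫⁻ y, (Metric.closedBall c a).indicator (fun _ => ENNReal.ofReal (2 * b)) y := by
        refine lintegral_mono fun y => ?_
        by_cases hy : y ∈ Metric.closedBall c a
        · rw [Set.indicator_of_mem hy, ← Real.volume_closedBall (f y) b]
          refine measure_mono fun x hx => ?_
          simpa [Real.dist_eq] using hx.2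
        · rw [Set.indicator_of_notMem hy, nonpos_iff_eq_zero]
          convert measure_empty (μ := (volume : Measure ℝ))
          ext x
          have : ¬ |y - c| ≤ a := by simpa [Real.dist_eq] using hy
          simp [this]
    _ = _ := by
        rw [lintegral_indicator_const Metric.isClosed_closedBall.measurableSet,
          Real.volume_closedBall, mul_comm]

theorem measurableSet_Rblock (ε : ℝ) (j k : ℕ) : MeasurableSet (Rblock ε j k) := by
  unfold Rblock
  measurability

/-- Volume of the intersection of a block with a translate (possibly reflected) of another one. -/
theorem volume_Rblock_inter_le {ε ε' s : ℝ} (hε : |ε| = 1) (hε' : |ε'| = 1) (hs : |s| = 1)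
    {j j' k k' J K : ℕ} (hJ : J = j ∨ J = j') (hK : K = k ∨ K = k') (z : ℝ × ℝ) :
    volume {p | p ∈ Rblock ε j k ∧ s • (p - z) ∈ Rblock ε' j' k'} ≤
      ENNReal.ofReal (16 * (2 : ℝ) ^ ((J : ℝ) + K)) := by
  have hs2 : s * s = 1 := by rw [← abs_mul_abs_self, hs, one_mul]
  obtain ⟨c, hc⟩ : ∃ c : ℝ, ∀ p : ℝ × ℝ, p ∈ Rblock ε j k → s • (p - z) ∈ Rblock ε' j' k' →
      |p.2 - c| ≤ (2 : ℝ) ^ ((J : ℝ) + 1) := by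
    rcases hJ with rfl | rfl
    · refine ⟨0, fun p hp _ => ?_⟩
      have h0 : 0 ≤ ε * p.2 := le_trans (by positivity) hp.1
      calc |p.2 - 0| = |ε * p.2| := by rw [abs_mul, hε, one_mul, sub_zero]
        _ ≤ _ := (abs_of_nonneg h0).trans_le hp.2.1
    · refine ⟨z.2, fun p _ hp => ?_⟩
      have h0 : 0 ≤ ε' * (s * (p.2 - z.2)) := le_trans (by positivity) hp.1
      calc |p.2 - z.2| = |ε' * (s * (p.2 - z.2))| := by
            rw [abs_mul, abs_mul, hε', hs, one_mul, one_mul]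
        _ ≤ _ := (abs_of_nonneg h0).trans_le hp.2.1
  obtain ⟨f, hfm, hf⟩ : ∃ f : ℝ → ℝ, Measurable f ∧ ∀ p : ℝ × ℝ, p ∈ Rblock ε j k →
      s • (p - z) ∈ Rblock ε' j' k' → |p.1 - f p.2| ≤ (2 : ℝ) ^ ((K : ℝ) + 1) := by
    rcases hK with rfl | rfl
    · exact ⟨fun ξ => ε * ξ ^ 2, by fun_prop, fun p hp _ => hp.2.2.2⟩
    · refine ⟨fun ξ => z.1 + s * (ε' * (s * (ξ - z.2)) ^ 2), by fun_prop, fun p _ hp => ?_⟩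
      have h : |s * (p.1 - z.1) - ε' * (s * (p.2 - z.2)) ^ 2| ≤ (2 : ℝ) ^ ((K : ℝ) + 1) :=
        hp.2.2.2
      have heq : s * (p.1 - (z.1 + s * (ε' * (s * (p.2 - z.2)) ^ 2))) =
          s * (p.1 - z.1) - ε' * (s * (p.2 - z.2)) ^ 2 := by
        linear_combination (-(ε' * (s * (p.2 - z.2)) ^ 2)) * hs2
      rwa [← heq, abs_mul, hs, one_mul] at h
  calc _ ≤ volume {p : ℝ × ℝ | |p.2 - c| ≤ (2 : ℝ) ^ ((J : ℝ) + 1) ∧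
        |p.1 - f p.2| ≤ (2 : ℝ) ^ ((K : ℝ) + 1)} :=
        measure_mono fun p hp => ⟨hc p hp.1 hp.2, hf p hp.1 hp.2⟩
    _ ≤ _ := volume_strip_le hfm _ _ _
    _ = _ := by
        rw [← ENNReal.ofReal_mul (by positivity), Real.rpow_add_one two_ne_zero,
          Real.rpow_add_one two_ne_zero, Real.rpow_add two_pos]
        congr 1
        ring

/-- A Schwartz function on `ℝ × ℝ`, viewed on the Euclidean plane. -/
def schwartzEuclidean (u : 𝓢(ℝ × ℝ, ℂ)) : 𝓢(WithLp 2 (ℝ × ℝ), ℂ) :=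
  SchwartzMap.compCLMOfContinuousLinearEquiv ℂ (WithLp.prodContinuousLinearEquiv 2 ℝ ℝ ℝ) u

theorem schwartzEuclidean_apply (u : 𝓢(ℝ × ℝ, ℂ)) (x : WithLp 2 (ℝ × ℝ)) :
    schwartzEuclidean u x = u x.ofLp := rfl

theorem FT2_eq_fourier (u : 𝓢(ℝ × ℝ, ℂ)) (q : ℝ × ℝ) :
    FT2 u q = 𝓕 (schwartzEuclidean u) (WithLp.toLp 2 q) := by
  rw [SchwartzMap.fourier_coe, Real.fourier_eq', FT2,
    ← (WithLp.volume_preserving_toLp ℝ ℝ).integral_comp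
      (MeasurableEquiv.toLp 2 (ℝ × ℝ)).measurableEmbedding]
  congr 1 with p
  simp only [schwartzEuclidean_apply, smul_eq_mul, WithLp.prod_inner_apply, RCLike.inner_apply,
    conj_trivial]
  congr 2
  push_cast
  ring

theorem continuous_FT2 (u : 𝓢(ℝ × ℝ, ℂ)) : Continuous (FT2 u) := by
  rw [funext (FT2_eq_fourier u)]
  exact (𝓕 (schwartzEuclidean u)).continuous.comp (WithLp.prod_continuous_toLp 2 ℝ ℝ)

/-- Plancherel's theorem for `FT2`. -/
theorem eLpNorm_FT2 (u : 𝓢(ℝ × ℝ, ℂ)) : eLpNorm (FT2 u) 2 volume = eLpNorm u 2 volume := by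
  have h := SchwartzMap.norm_fourier_toL2_eq (schwartzEuclidean u)
  rw [SchwartzMap.norm_toLp, SchwartzMap.norm_toLp, ENNReal.toReal_eq_toReal_iff'
    (SchwartzMap.memLp _ _ _).2.ne (SchwartzMap.memLp _ _ _).2.ne] at h
  rw [← eLpNorm_comp_measurePreserving (SchwartzMap.continuous _).aestronglyMeasurable
    (WithLp.volume_preserving_toLp ℝ ℝ), ← eLpNorm_comp_measurePreserving
    (SchwartzMap.continuous _).aestronglyMeasurable (WithLp.volume_preserving_toLp ℝ ℝ)] at h
  rw [funext (FT2_eq_fourier u)]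
  exact h

/-- The pointwise product of two Schwartz functions. -/
def schwartzMul (u v : 𝓢(ℝ × ℝ, ℂ)) : 𝓢(ℝ × ℝ, ℂ) :=
  SchwartzMap.pairing (ContinuousLinearMap.mul ℂ ℂ) u v

theorem coe_schwartzMul (u v : 𝓢(ℝ × ℝ, ℂ)) : ⇑(schwartzMul u v) = fun p => u p * v p := rfl

/-- The Fourier transform of a product is the convolution of the Fourier transforms. -/
theorem FT2_schwartzMul (u v : 𝓢(ℝ × ℝ, ℂ)) (q : ℝ × ℝ) :
    FT2 (schwartzMul u v) q = ∫ p, FT2 u p * FT2 v (q - p) := by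
  have inv_eq (f : 𝓢(WithLp 2 (ℝ × ℝ), ℂ)) (x : WithLp 2 (ℝ × ℝ)) : 𝓕⁻ f x = 𝓕 f (-x) := by
    rw [SchwartzMap.fourierInv_coe, SchwartzMap.fourier_coe, Real.fourierInv_eq_fourier_neg]
  have h := SchwartzMap.convolution_apply (ContinuousLinearMap.mul ℂ ℂ)
    (𝓕⁻ (schwartzEuclidean u)) (𝓕⁻ (schwartzEuclidean v)) (-WithLp.toLp 2 q)
  have hprod : SchwartzMap.pairing (ContinuousLinearMap.mul ℂ ℂ) (schwartzEuclidean u) (schwartzEuclidean v) =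
      schwartzEuclidean (schwartzMul u v) := rfl
  have hconv : SchwartzMap.convolution (ContinuousLinearMap.mul ℂ ℂ)
      (𝓕⁻ (schwartzEuclidean u)) (𝓕⁻ (schwartzEuclidean v)) = 𝓕⁻ (schwartzEuclidean (schwartzMul u v)) := by
    rw [← hprod]
    simp [SchwartzMap.convolution]
  rw [hconv, inv_eq, neg_neg, ← FT2_eq_fourier] at h
  rw [h, MeasureTheory.convolution, ← integral_neg_eq_self,
    ← (WithLp.volume_preserving_toLp ℝ ℝ).integral_comp
      (MeasurableEquiv.toLp 2 (ℝ × ℝ)).measurableEmbedding]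
  congr 1 with p
  rw [FT2_eq_fourier, FT2_eq_fourier, inv_eq, inv_eq, ContinuousLinearMap.mul_apply', neg_neg,
    WithLp.toLp_sub]
  congr 2
  abel

theorem sq_eLpNorm_two {α F : Type*} [MeasurableSpace α] [NormedAddCommGroup F] (μ : Measure α)
    (f : α → F) : eLpNorm f 2 μ ^ 2 = ∫⁻ a, ‖f a‖ₑ ^ 2 ∂μ := by
  simpa using eLpNorm_nnreal_pow_eq_lintegral (f := f) (μ := μ) (p := 2) two_ne_zero

/-- **Sobolev-type bilinear block estimate**:
`‖1_{R^+_{j''k''}} 𝓕(uv)‖_{L²} ≲ 2^{(j♭+k♭)/2} ‖u‖_{L²} ‖v‖_{L²}` for space–time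
functions with Fourier support in dyadic blocks `R^+_{jk}` and `R^±_{j'k'}`. -/
theorem bilinear_block_sobolev :
    ∃ C : ℝ, 0 < C ∧
      ∀ (ε : ℝ), (ε = 1 ∨ ε = -1) →
      ∀ (j j' j'' k k' k'' : ℕ) (u v : 𝓢(ℝ × ℝ, ℂ)),
        Function.support (FT2 ⇑u) ⊆ Rblock 1 j k →
        Function.support (FT2 ⇑v) ⊆ Rblock ε j' k' →
        eLpNorm ((Rblock 1 j'' k'').indicator (FT2 fun p => u p * v p)) 2
            (volume : Measure (ℝ × ℝ))
          ≤ ENNReal.ofReal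
              (C * (2 : ℝ) ^ (((min3 j j' j'' : ℝ) + (min3 k k' k'' : ℝ)) / 2)) *
            eLpNorm (⇑u) 2 (volume : Measure (ℝ × ℝ)) *
            eLpNorm (⇑v) 2 (volume : Measure (ℝ × ℝ)) := by
  refine ⟨4, by norm_num, ?_⟩
  intro ε hε j j' j'' k k' k'' u v hu hv
  have hε1 : |ε| = 1 := by rcases hε with rfl | rfl <;> simp
  set J := min3 j j' j'' with hJ
  set K := min3 k k' k'' with hK
  rw [← coe_schwartzMul, ← ENNReal.pow_le_pow_left_iff two_ne_zero, mul_pow, mul_pow,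
    ← eLpNorm_FT2 u, ← eLpNorm_FT2 v, sq_eLpNorm_two, sq_eLpNorm_two, sq_eLpNorm_two,
    ← ENNReal.ofReal_pow (by positivity)]
  have hconst : (4 * (2 : ℝ) ^ (((J : ℝ) + K) / 2)) ^ 2 = 16 * (2 : ℝ) ^ ((J : ℝ) + K) := by
    rw [mul_pow, ← Real.rpow_mul_natCast two_pos.le]
    norm_num
  rw [hconst]
  have hfin : ∫⁻ q, ‖(Rblock 1 j'' k'').indicator (FT2 (schwartzMul u v)) q‖ₑ ^ 2 ≠ ∞ := by
    rw [← sq_eLpNorm_two]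
    refine ENNReal.pow_ne_top (ne_top_of_le_ne_top ?_ (eLpNorm_indicator_le _))
    rw [eLpNorm_FT2]
    exact (SchwartzMap.memLp _ _ _).2.ne
  have hmem {w : ℝ × ℝ → ℂ} {δ : ℝ} {a b : ℕ} (hw : Function.support w ⊆ Rblock δ a b)
      {p : ℝ × ℝ} (hp : ‖w p‖ₑ ≠ 0) : p ∈ Rblock δ a b := hw (by simpa using hp)
  have hW : Function.support ((Rblock 1 j'' k'').indicator (FT2 (schwartzMul u v))) ⊆
      Rblock 1 j'' k'' := Set.support_indicator_subset
  have hcases :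
      ((J = j ∨ J = j') ∧ (K = k ∨ K = k')) ∨ ((J = j'' ∨ J = j') ∧ (K = k'' ∨ K = k')) ∨
        ((J = j'' ∨ J = j) ∧ (K = k'' ∨ K = k)) := by
    unfold min3 at hJ hK
    omega
  refine lintegral_sq_le_of_le_convolution (continuous_FT2 u).measurable.enorm
    (continuous_FT2 v).measurable.enorm
    ((continuous_FT2 _).measurable.indicator (measurableSet_Rblock 1 j'' k'')).enorm
    (fun q => ?_) hfin ?_
  · rw [enorm_indicator_eq_indicator_enorm]
    refine (Set.indicator_le_self _ _ q).trans ?_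
    rw [FT2_schwartzMul]
    exact (enorm_integral_le_lintegral_enorm _).trans_eq (by simp_rw [enorm_mul])
  · refine hcases.imp (fun h z => ?_) (Or.imp (fun h z => ?_) (fun h z => ?_))
    · refine (measure_mono fun p hp => ?_).trans
        (volume_Rblock_inter_le abs_one hε1 (s := -1) (by simp) h.1 h.2 z)
      exact ⟨hmem hu hp.1, by simpa using hmem hv hp.2⟩
    · refine (measure_mono fun p hp => ?_).trans
        (volume_Rblock_inter_le abs_one hε1 abs_one h.1 h.2 z)
      exact ⟨hmem hW hp.1, by simpa using hmem hv hp.2⟩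
    · refine (measure_mono fun p hp => ?_).trans
        (volume_Rblock_inter_le abs_one abs_one abs_one h.1 h.2 z)
      exact ⟨hmem hW hp.1, by simpa using hmem hu hp.2⟩

end
end
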